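/- Let N ≥ 2. The uniform distribution U on Δ_{N−1} is an invariant probability measure for the coagulation–fragmentation kernel K, it is the unique invariant probability measure of K, and for every initial probability measure μ_0 on Δ_{N−1} the time-t marginals μ_t = μ_0 K^t converge weakly to U as t → ∞. -/

import Mathlib

open MeasureTheory Filter
open scoped ENNReal NNReal Topology

/-- The coagulation–fragmentation map `T_{i,j,u}` on `ℝ^N`: the `i`-th coordinate of the
output is `u (x_i + x_j)`, the `j`-th coordinate is `(1-u)(x_i + x_j)`, and all other
coordinates are unchanged. -/
noncomputable def cfT (N : ℕ) (i j : Fin N) (u : ℝ) (x : Fin N → ℝ) : Fin N → ℝ :=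
  Function.update (Function.update x i (u * (x i + x j))) j ((1 - u) * (x i + x j))

/-- The coagulation–fragmentation kernel on the simplex `Δ_{N-1}`, viewed as a
measure-valued map: `K(x, A) = (1/(N(N-1))) ∑_{(i,j) : i ≠ j} Leb{u ∈ [0,1] : T_{i,j,u}(x) ∈ A}`. -/
noncomputable def cfK (N : ℕ) (x : Fin N → ℝ) : Measure (Fin N → ℝ) :=
  ((N : ℝ≥0∞) * ((N : ℝ≥0∞) - 1))⁻¹ •
    ∑ p ∈ Finset.univ.filter (fun p : Fin N × Fin N => p.1 ≠ p.2),
      (volume.restrict (Set.Icc (0 : ℝ) 1)).map (fun u => cfT N p.1 p.2 u x)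

/-- The uniform distribution on the simplex `Δ_{N-1}`: the `(N-1)`-dimensional Hausdorff
measure restricted to `Δ_{N-1}` and normalized to be a probability measure. -/
noncomputable def uniformSimplex (N : ℕ) : Measure (Fin N → ℝ) :=
  (μH[(N : ℝ) - 1] (stdSimplex ℝ (Fin N)))⁻¹ •
    μH[(N : ℝ) - 1].restrict (stdSimplex ℝ (Fin N))

/-- Iterated action of a (measure-valued) Markov transition `κ` on an initial
distribution: `evolve κ k μ = μ κ^k` is the time-`k` marginal of the chain with initial
distribution `μ` and transition kernel `κ`. -/
noncomputable def evolve {α : Type*} [MeasurableSpace α] (κ : α → Measure α) :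
    ℕ → Measure α → Measure α
  | 0, μ => μ
  | k + 1, μ => (evolve κ k μ).bind κ

theorem continuous_cfT (N : ℕ) (i j : Fin N) :
    Continuous (fun q : (Fin N → ℝ) × ℝ => cfT N i j q.2 q.1) := by
  unfold cfT
  refine Continuous.update (Continuous.update (by fun_prop) i (by fun_prop)) j (by fun_prop)

theorem measurable_cfT_left (N : ℕ) (i j : Fin N) (x : Fin N → ℝ) :
    Measurable (fun u : ℝ => cfT N i j u x) :=
  ((continuous_cfT N i j).comp (Continuous.prodMk_right x)).measurable

theorem sum_sub_pair_eq {ι : Type*} [Fintype ι] [DecidableEq ι] {i j : ι} (hij : i ≠ j)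
    {F G : ι → ℝ} (h : ∀ k, k ≠ i → k ≠ j → F k = G k) :
    ∑ k, F k - (F i + F j) = ∑ k, G k - (G i + G j) := by
  have key (H : ι → ℝ) :
      ∑ k, H k - (H i + H j) = ∑ k ∈ (Finset.univ.erase i).erase j, H k := by
    rw [← Finset.add_sum_erase _ _ (Finset.mem_univ i),
      ← Finset.add_sum_erase (Finset.univ.erase i) _
        (Finset.mem_erase.2 ⟨hij.symm, Finset.mem_univ j⟩)]
    ring
  rw [key, key]
  refine Finset.sum_congr rfl fun k hk => ?_
  simp only [Finset.mem_erase, Finset.mem_univ, and_true] at hk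
  exact h k hk.2 hk.1

theorem cfT_fst {N : ℕ} {i j : Fin N} (hij : i ≠ j) (u : ℝ) (x : Fin N → ℝ) :
    cfT N i j u x i = u * (x i + x j) := by
  simp [cfT, hij]

theorem cfT_snd {N : ℕ} (i j : Fin N) (u : ℝ) (x : Fin N → ℝ) :
    cfT N i j u x j = (1 - u) * (x i + x j) := by
  simp [cfT]

theorem cfT_of_ne {N : ℕ} {i j k : Fin N} (hi : k ≠ i) (hj : k ≠ j) (u : ℝ) (x : Fin N → ℝ) :
    cfT N i j u x k = x k := by
  simp [cfT, hi, hj]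

theorem sum_cfT {N : ℕ} {i j : Fin N} (hij : i ≠ j) (u : ℝ) (x : Fin N → ℝ) :
    ∑ k, cfT N i j u x k = ∑ k, x k := by
  have h := sum_sub_pair_eq hij (F := cfT N i j u x) (G := x)
    fun k hi hj => cfT_of_ne hi hj u x
  rw [cfT_fst hij, cfT_snd] at h
  linarith

theorem cfT_mem_stdSimplex {N : ℕ} {i j : Fin N} (hij : i ≠ j) {u : ℝ}
    (hu : u ∈ Set.Icc (0 : ℝ) 1) {x : Fin N → ℝ} (hx : x ∈ stdSimplex ℝ (Fin N)) :
    cfT N i j u x ∈ stdSimplex ℝ (Fin N) := by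
  refine ⟨fun k => ?_, (sum_cfT hij u x).trans hx.2⟩
  have hs : 0 ≤ x i + x j := add_nonneg (hx.1 i) (hx.1 j)
  by_cases hj : k = j
  · subst hj
    rw [cfT_snd]
    exact mul_nonneg (sub_nonneg.2 hu.2) hs
  by_cases hi : k = i
  · subst hi
    rw [cfT_fst hij]
    exact mul_nonneg hu.1 hs
  · rw [cfT_of_ne hi hj]
    exact hx.1 k

/-- Squared Euclidean distance between two vectors. -/
noncomputable def sqDist {N : ℕ} (x y : Fin N → ℝ) : ℝ := ∑ k, (x k - y k) ^ 2

theorem sqDist_cfT {N : ℕ} {i j : Fin N} (hij : i ≠ j) (u : ℝ) (x y : Fin N → ℝ) :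
    sqDist (cfT N i j u x) (cfT N i j u y) =
      sqDist x y - ((x i - y i) ^ 2 + (x j - y j) ^ 2) +
        (u ^ 2 + (1 - u) ^ 2) * ((x i - y i) + (x j - y j)) ^ 2 := by
  have h := sum_sub_pair_eq hij
    (F := fun k => (cfT N i j u x k - cfT N i j u y k) ^ 2) (G := fun k => (x k - y k) ^ 2)
    fun k hi hj => by simp only [cfT_of_ne hi hj]
  simp only [cfT_fst hij, cfT_snd] at h
  unfold sqDist
  linear_combination h

theorem sqDist_le_two {N : ℕ} {x y : Fin N → ℝ} (hx : x ∈ stdSimplex ℝ (Fin N))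
    (hy : y ∈ stdSimplex ℝ (Fin N)) : sqDist x y ≤ 2 := by
  have h : ∀ k, (x k - y k) ^ 2 ≤ x k + y k := fun k => by
    have h1 := hx.1 k
    have h2 := hy.1 k
    have h3 : x k ≤ 1 := hx.2 ▸ Finset.single_le_sum (fun l _ => hx.1 l) (Finset.mem_univ k)
    have h4 : y k ≤ 1 := hy.2 ▸ Finset.single_le_sum (fun l _ => hy.1 l) (Finset.mem_univ k)
    nlinarith [mul_nonneg h1 h2, mul_nonneg h1 (sub_nonneg.2 h3), mul_nonneg h2 (sub_nonneg.2 h4)]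
  calc sqDist x y ≤ ∑ k, (x k + y k) := Finset.sum_le_sum fun k _ => h k
    _ = 2 := by rw [Finset.sum_add_distrib, hx.2, hy.2]; norm_num

theorem setIntegral_sq_add_one_sub_sq (a b : ℝ) :
    ∫ u in Set.Icc (0 : ℝ) 1, (a + (u ^ 2 + (1 - u) ^ 2) * b) = a + 2 / 3 * b := by
  rw [integral_Icc_eq_integral_Ioc, ← intervalIntegral.integral_of_le zero_le_one]
  have : ∀ u ∈ Set.uIcc (0 : ℝ) 1, HasDerivAt
      (fun u : ℝ => a * u + (u ^ 3 / 3 - (1 - u) ^ 3 / 3) * b) (a + (u ^ 2 + (1 - u) ^ 2) * b) u := by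
    intro u _
    have h1 : HasDerivAt (fun u : ℝ => u) 1 u := hasDerivAt_id u
    have h2 := (h1.const_mul a).add ((((h1.pow 3).div_const 3).sub
      ((((hasDerivAt_const u (1 : ℝ)).sub h1).pow 3).div_const 3)).mul_const b)
    refine h2.congr_deriv ?_
    simp only [Pi.sub_apply, Nat.cast_ofNat]
    ring
  rw [intervalIntegral.integral_eq_sub_of_hasDerivAt this
    (Continuous.intervalIntegrable (by fun_prop) _ _)]
  ring

theorem sum_offDiag_eq {N : ℕ} {d : Fin N → ℝ} (hd : ∑ k, d k = 0) (D : ℝ)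
    (hD : D = ∑ k, d k ^ 2) :
    ∑ p ∈ Finset.univ.filter (fun p : Fin N × Fin N => p.1 ≠ p.2),
      (D - (d p.1 ^ 2 + d p.2 ^ 2) + 2 / 3 * (d p.1 + d p.2) ^ 2) =
    ((N : ℝ) * (N - 1) - 2 * (N + 1) / 3) * D := by
  have hfull : ∑ p : Fin N × Fin N,
      (D - (d p.1 ^ 2 + d p.2 ^ 2) + 2 / 3 * (d p.1 + d p.2) ^ 2) =
      (N : ℝ) * N * D - 2 / 3 * N * D := by
    have hin : ∀ i, ∑ j, (D - (d i ^ 2 + d j ^ 2) + 2 / 3 * (d i + d j) ^ 2) =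
        N * D - 1 / 3 * D - 1 / 3 * N * d i ^ 2 := fun i => by
      have : ∀ j, (D - (d i ^ 2 + d j ^ 2) + 2 / 3 * (d i + d j) ^ 2) =
        (D - 1 / 3 * d i ^ 2) + (-1 / 3) * d j ^ 2 + 4 / 3 * d i * d j := fun j => by ring
      simp only [this, Finset.sum_add_distrib, ← Finset.mul_sum, hd, ← hD]
      simp
      ring
    rw [Fintype.sum_prod_type]
    simp only [hin, Finset.sum_sub_distrib, ← Finset.mul_sum, ← hD]
    simp
    ring
  have hdiag : ∑ p ∈ Finset.univ.filter (fun p : Fin N × Fin N => ¬ p.1 ≠ p.2),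
      (D - (d p.1 ^ 2 + d p.2 ^ 2) + 2 / 3 * (d p.1 + d p.2) ^ 2) = N * D + 2 / 3 * D := by
    simp only [ne_eq, not_not]
    rw [Finset.sum_filter, Fintype.sum_prod_type]
    simp only [Finset.sum_ite_eq, Finset.mem_univ, if_true]
    have : ∀ i, (D - (d i ^ 2 + d i ^ 2) + 2 / 3 * (d i + d i) ^ 2) = D + 2 / 3 * d i ^ 2 :=
      fun i => by ring
    simp only [this, Finset.sum_add_distrib, ← Finset.mul_sum, ← hD]
    simp
  have hsplit := Finset.sum_filter_add_sum_filter_not Finset.univ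
    (fun p : Fin N × Fin N => p.1 ≠ p.2)
    (fun p => D - (d p.1 ^ 2 + d p.2 ^ 2) + 2 / 3 * (d p.1 + d p.2) ^ 2)
  rw [hfull, hdiag] at hsplit
  linear_combination hsplit

theorem card_filter_fst_ne_snd (N : ℕ) :
    ((Finset.univ.filter (fun p : Fin N × Fin N => p.1 ≠ p.2)).card : ℝ) = N * (N - 1) := by
  have h := Finset.card_filter_add_card_filter_not (s := Finset.univ)
    (fun p : Fin N × Fin N => p.1 = p.2)
  have hd : (Finset.univ.filter (fun p : Fin N × Fin N => p.1 = p.2)).card = N := by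
    rw [Finset.card_filter, Fintype.sum_prod_type]
    simp
  rw [hd] at h
  have h' := congrArg (Nat.cast : ℕ → ℝ) h
  simp at h'
  simp only [ne_eq]
  linear_combination h'

theorem lintegral_cfK (N : ℕ) {g : (Fin N → ℝ) → ℝ≥0∞} (hg : Measurable g) (x : Fin N → ℝ) :
    ∫⁻ y, g y ∂(cfK N x) = ((N : ℝ≥0∞) * ((N : ℝ≥0∞) - 1))⁻¹ *
      ∑ p ∈ Finset.univ.filter (fun p : Fin N × Fin N => p.1 ≠ p.2),
        ∫⁻ u in Set.Icc (0 : ℝ) 1, g (cfT N p.1 p.2 u x) := by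
  rw [cfK, lintegral_smul_measure, lintegral_finsetSum_measure, smul_eq_mul]
  congr 1
  refine Finset.sum_congr rfl fun p _ => ?_
  exact lintegral_map hg (measurable_cfT_left N p.1 p.2 x)

theorem measurable_cfK (N : ℕ) : Measurable (cfK N) := by
  refine Measure.measurable_of_measurable_coe _ fun s hs => ?_
  have h : ∀ x, cfK N x s = _ := fun x => by
    rw [← lintegral_indicator_one hs, lintegral_cfK N (measurable_one.indicator hs)]
  simp only [h]
  refine Measurable.const_mul (Finset.measurable_sum _ fun p _ => ?_) _
  exact Measurable.lintegral_prod_right'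
    (f := fun q : (Fin N → ℝ) × ℝ => s.indicator 1 (cfT N p.1 p.2 q.2 q.1))
    ((measurable_one.indicator hs).comp (continuous_cfT N p.1 p.2).measurable)

theorem natCast_mul_sub_one_eq_ofReal {N : ℕ} (hN : 2 ≤ N) :
    (N : ℝ≥0∞) * ((N : ℝ≥0∞) - 1) = ENNReal.ofReal ((N : ℝ) * (N - 1)) := by
  rw [ENNReal.ofReal_mul (by positivity), ENNReal.ofReal_sub _ zero_le_one]
  simp

theorem natCast_mul_sub_one_pos {N : ℕ} (hN : 2 ≤ N) : 0 < (N : ℝ) * (N - 1) := by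
  have : (2 : ℝ) ≤ N := by exact_mod_cast hN
  exact mul_pos (by linarith) (by linarith)

theorem natCast_card_filter_ne {N : ℕ} (hN : 2 ≤ N) :
    ((Finset.univ.filter (fun p : Fin N × Fin N => p.1 ≠ p.2)).card : ℝ≥0∞) =
      (N : ℝ≥0∞) * ((N : ℝ≥0∞) - 1) := by
  rw [natCast_mul_sub_one_eq_ofReal hN, ← card_filter_fst_ne_snd, ENNReal.ofReal_natCast]

theorem inv_mul_natCast_mul_sub_one {N : ℕ} (hN : 2 ≤ N) :
    ((N : ℝ≥0∞) * ((N : ℝ≥0∞) - 1))⁻¹ * ((N : ℝ≥0∞) * ((N : ℝ≥0∞) - 1)) = 1 := by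
  rw [natCast_mul_sub_one_eq_ofReal hN]
  exact ENNReal.inv_mul_cancel (ENNReal.ofReal_pos.2 (natCast_mul_sub_one_pos hN)).ne'
    ENNReal.ofReal_ne_top

theorem isProbabilityMeasure_cfK {N : ℕ} (hN : 2 ≤ N) (x : Fin N → ℝ) :
    IsProbabilityMeasure (cfK N x) := by
  constructor
  rw [← lintegral_one, lintegral_cfK N measurable_const]
  simp only [lintegral_one, Measure.restrict_apply_univ, Real.volume_Icc, sub_zero,
    ENNReal.ofReal_one, Finset.sum_const, nsmul_eq_mul, mul_one]
  rw [natCast_card_filter_ne hN, inv_mul_natCast_mul_sub_one hN]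

/-- The coagulation–fragmentation transition bundled as a Mathlib kernel. -/
noncomputable def cfKernel (N : ℕ) : ProbabilityTheory.Kernel (Fin N → ℝ) (Fin N → ℝ) :=
  ⟨cfK N, measurable_cfK N⟩

theorem isMarkovKernel_cfKernel {N : ℕ} (hN : 2 ≤ N) :
    ProbabilityTheory.IsMarkovKernel (cfKernel N) :=
  ⟨fun x => isProbabilityMeasure_cfK hN x⟩

theorem integral_cfK {N : ℕ} (hN : 2 ≤ N) {g : (Fin N → ℝ) → ℝ} (hg : Measurable g) {M : ℝ}
    (hM : ∀ x, |g x| ≤ M) (x : Fin N → ℝ) :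
    ∫ y, g y ∂(cfK N x) = ((N : ℝ) * (N - 1))⁻¹ *
      ∑ p ∈ Finset.univ.filter (fun p : Fin N × Fin N => p.1 ≠ p.2),
        ∫ u in Set.Icc (0 : ℝ) 1, g (cfT N p.1 p.2 u x) := by
  rw [cfK, integral_smul_measure, integral_finsetSum_measure, natCast_mul_sub_one_eq_ofReal hN,
    ENNReal.toReal_inv, ENNReal.toReal_ofReal (natCast_mul_sub_one_pos hN).le, smul_eq_mul]
  · congr 1
    refine Finset.sum_congr rfl fun p _ => ?_
    exact integral_map (measurable_cfT_left N p.1 p.2 x).aemeasurable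
      hg.aestronglyMeasurable
  · intro p _
    exact Integrable.of_bound hg.aestronglyMeasurable M (ae_of_all _ hM)

/-- One-step contraction factor of the squared distance under the synchronous coupling. -/
noncomputable def cfRate (N : ℕ) : ℝ := 1 - 2 * (N + 1) / (3 * (N * (N - 1)))

theorem cfRate_lt_one {N : ℕ} (hN : 2 ≤ N) : cfRate N < 1 := by
  have := natCast_mul_sub_one_pos hN
  unfold cfRate
  have : (0 : ℝ) < 2 * (N + 1) / (3 * (N * (N - 1))) := by positivity
  linarith

theorem cfRate_nonneg {N : ℕ} (hN : 2 ≤ N) : 0 ≤ cfRate N := by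
  have h0 := natCast_mul_sub_one_pos hN
  have h2 : (2 : ℝ) ≤ N := by exact_mod_cast hN
  unfold cfRate
  rw [sub_nonneg, div_le_one (by positivity)]
  nlinarith

theorem abs_integral_cfK_sub_le {N : ℕ} (hN : 2 ≤ N) {g : (Fin N → ℝ) → ℝ} (hg : Measurable g)
    {M : ℝ} (hM : ∀ x, |g x| ≤ M) {ε C : ℝ}
    (h : ∀ x ∈ stdSimplex ℝ (Fin N), ∀ y ∈ stdSimplex ℝ (Fin N),
      |g x - g y| ≤ ε + C * sqDist x y)
    {x y : Fin N → ℝ} (hx : x ∈ stdSimplex ℝ (Fin N)) (hy : y ∈ stdSimplex ℝ (Fin N)) :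
    |∫ z, g z ∂(cfK N x) - ∫ z, g z ∂(cfK N y)| ≤ ε + C * cfRate N * sqDist x y := by
  have hpos := natCast_mul_sub_one_pos hN
  have hint (p : Fin N × Fin N) (z : Fin N → ℝ) :
      IntegrableOn (fun u => g (cfT N p.1 p.2 u z)) (Set.Icc (0 : ℝ) 1) :=
    Integrable.of_bound (hg.comp (measurable_cfT_left N p.1 p.2 z)).aestronglyMeasurable M
      (ae_of_all _ fun u => hM _)
  have hpair : ∀ p ∈ Finset.univ.filter (fun p : Fin N × Fin N => p.1 ≠ p.2),
      |(∫ u in Set.Icc (0 : ℝ) 1, g (cfT N p.1 p.2 u x)) -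
        ∫ u in Set.Icc (0 : ℝ) 1, g (cfT N p.1 p.2 u y)| ≤
      ε + C * (sqDist x y - ((x p.1 - y p.1) ^ 2 + (x p.2 - y p.2) ^ 2) +
        2 / 3 * ((x p.1 - y p.1) + (x p.2 - y p.2)) ^ 2) := by
    intro p hp
    have hij : p.1 ≠ p.2 := (Finset.mem_filter.1 hp).2
    rw [← integral_sub (hint p x) (hint p y)]
    have e : ε + C * (sqDist x y - ((x p.1 - y p.1) ^ 2 + (x p.2 - y p.2) ^ 2) +
        2 / 3 * ((x p.1 - y p.1) + (x p.2 - y p.2)) ^ 2) =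
        (ε + C * (sqDist x y - ((x p.1 - y p.1) ^ 2 + (x p.2 - y p.2) ^ 2))) +
          2 / 3 * (C * ((x p.1 - y p.1) + (x p.2 - y p.2)) ^ 2) := by ring
    rw [e, ← setIntegral_sq_add_one_sub_sq, ← Real.norm_eq_abs]
    refine norm_integral_le_of_norm_le
      (Continuous.integrableOn_Icc (by fun_prop)) ?_
    refine (ae_restrict_mem measurableSet_Icc).mono fun u hu => ?_
    refine (h _ (cfT_mem_stdSimplex hij hu hx) _ (cfT_mem_stdSimplex hij hu hy)).trans_eq ?_
    rw [sqDist_cfT hij]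
    ring
  rw [integral_cfK hN hg hM, integral_cfK hN hg hM, ← mul_sub, ← Finset.sum_sub_distrib, abs_mul,
    abs_of_pos (inv_pos.2 hpos), inv_mul_le_iff₀ hpos]
  refine ((Finset.abs_sum_le_sum_abs _ _).trans (Finset.sum_le_sum hpair)).trans_eq ?_
  have hd : ∑ k, (x k - y k) = 0 := by rw [Finset.sum_sub_distrib, hx.2, hy.2, sub_self]
  rw [Finset.sum_add_distrib, ← Finset.mul_sum, sum_offDiag_eq hd (sqDist x y) rfl,
    Finset.sum_const, nsmul_eq_mul, card_filter_fst_ne_snd]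
  unfold cfRate
  have hne : ((N : ℝ) - 1) ≠ 0 := right_ne_zero_of_mul hpos.ne'
  have hne' : (N : ℝ) ≠ 0 := left_ne_zero_of_mul hpos.ne'
  field_simp

theorem abs_integral_sub_integral_le {α : Type*} [MeasurableSpace α] {S : Set α}
    (hS : MeasurableSet S) {μ ν : Measure α} [IsProbabilityMeasure μ] [IsProbabilityMeasure ν]
    (hμ : μ S = 1) (hν : ν S = 1) {g : α → ℝ} (hgμ : Integrable g μ) (hgν : Integrable g ν)
    {B : ℝ} (h : ∀ x ∈ S, ∀ y ∈ S, |g x - g y| ≤ B) :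
    |∫ x, g x ∂μ - ∫ x, g x ∂ν| ≤ B := by
  have hμ' : ∀ᵐ x ∂μ, x ∈ S := (prob_compl_eq_zero_iff hS).2 hμ
  have hν' : ∀ᵐ x ∂ν, x ∈ S := (prob_compl_eq_zero_iff hS).2 hν
  have h1 : ∀ y ∈ S, |∫ x, g x ∂μ - g y| ≤ B := fun y hy => by
    have := norm_integral_le_of_norm_le_const (μ := μ) (f := fun x => g x - g y) (C := B)
      (hμ'.mono fun x hx => h x hx y hy)
    rw [integral_sub hgμ (integrable_const _)] at this
    simpa using this
  have := norm_integral_le_of_norm_le_const (μ := ν) (f := fun y => ∫ x, g x ∂μ - g y) (C := B)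
    (hν'.mono fun y hy => h1 y hy)
  rw [integral_sub (integrable_const _) hgν] at this
  simpa using this

theorem isProbabilityMeasure_evolve {N : ℕ} (hN : 2 ≤ N) (t : ℕ) (μ : Measure (Fin N → ℝ))
    [IsProbabilityMeasure μ] : IsProbabilityMeasure (evolve (cfK N) t μ) := by
  induction t with
  | zero => assumption
  | succ t ih =>
    have := isMarkovKernel_cfKernel hN
    exact inferInstanceAs (IsProbabilityMeasure ((evolve (cfK N) t μ).bind (cfKernel N)))

theorem integral_evolve_succ {N : ℕ} (hN : 2 ≤ N) (t : ℕ) (μ : Measure (Fin N → ℝ))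
    [IsProbabilityMeasure μ] {g : (Fin N → ℝ) → ℝ} (hg : Measurable g) {M : ℝ}
    (hM : ∀ x, |g x| ≤ M) :
    ∫ x, g x ∂(evolve (cfK N) (t + 1) μ) =
      ∫ x, (∫ y, g y ∂(cfK N x)) ∂(evolve (cfK N) t μ) := by
  have := isProbabilityMeasure_evolve hN (t + 1) μ
  have hint : Integrable g ((evolve (cfK N) t μ).bind (cfKernel N)) :=
    Integrable.of_bound (μ := evolve (cfK N) (t + 1) μ) hg.aestronglyMeasurable M (ae_of_all _ hM)
  change ∫ x, g x ∂((evolve (cfK N) t μ).bind (cfKernel N)) = _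
  rw [Measure.comp_eq_comp_const_apply] at hint ⊢
  rw [ProbabilityTheory.Kernel.integral_comp hint]
  rfl

theorem abs_integral_evolve_sub_le {N : ℕ} (hN : 2 ≤ N) {ε : ℝ} {μ ν : Measure (Fin N → ℝ)}
    [IsProbabilityMeasure μ] [IsProbabilityMeasure ν] (hμ : μ (stdSimplex ℝ (Fin N)) = 1)
    (hν : ν (stdSimplex ℝ (Fin N)) = 1) {M : ℝ} (t : ℕ) :
    ∀ {C : ℝ}, 0 ≤ C → ∀ {g : (Fin N → ℝ) → ℝ}, Measurable g → (∀ x, |g x| ≤ M) →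
    (∀ x ∈ stdSimplex ℝ (Fin N), ∀ y ∈ stdSimplex ℝ (Fin N),
      |g x - g y| ≤ ε + C * sqDist x y) →
    |∫ x, g x ∂(evolve (cfK N) t μ) - ∫ x, g x ∂(evolve (cfK N) t ν)| ≤
      ε + C * cfRate N ^ t * 2 := by
  induction t with
  | zero =>
    intro C hC g hg hM h
    refine abs_integral_sub_integral_le (isClosed_stdSimplex ℝ (Fin N)).measurableSet hμ hν
      (Integrable.of_bound hg.aestronglyMeasurable M (ae_of_all _ hM))
      (Integrable.of_bound hg.aestronglyMeasurable M (ae_of_all _ hM)) fun x hx y hy => ?_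
    refine (h x hx y hy).trans ?_
    rw [pow_zero, mul_one]
    gcongr
    exact sqDist_le_two hx hy
  | succ t ih =>
    intro C hC g hg hM h
    rw [integral_evolve_succ hN t μ hg hM, integral_evolve_succ hN t ν hg hM, pow_succ',
      ← mul_assoc]
    refine ih (mul_nonneg hC (cfRate_nonneg hN)) ?_ ?_
      fun x hx y hy => abs_integral_cfK_sub_le hN hg hM h hx hy
    · exact (hg.stronglyMeasurable.integral_kernel (κ := cfKernel N)).measurable
    · intro x
      have := isProbabilityMeasure_cfK hN x
      simpa using norm_integral_le_of_norm_le_const (μ := cfK N x) (f := g) (ae_of_all _ hM)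

theorem exists_abs_sub_le_add_mul_sqDist {N : ℕ} {f : (Fin N → ℝ) → ℝ} (hf : Continuous f)
    {M : ℝ} (hM : ∀ x, |f x| ≤ M) {ε : ℝ} (hε : 0 < ε) :
    ∃ C, 0 ≤ C ∧ ∀ x ∈ stdSimplex ℝ (Fin N), ∀ y ∈ stdSimplex ℝ (Fin N),
      |f x - f y| ≤ ε + C * sqDist x y := by
  have hM0 : 0 ≤ M := (abs_nonneg _).trans (hM 0)
  obtain ⟨δ, hδ, h⟩ := Metric.uniformContinuousOn_iff.1
    ((isCompact_stdSimplex ℝ (Fin N)).uniformContinuousOn_of_continuous hf.continuousOn) ε hε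
  refine ⟨2 * M / δ ^ 2, by positivity, fun x hx y hy => ?_⟩
  have hsq : 0 ≤ sqDist x y := Finset.sum_nonneg fun k _ => sq_nonneg _
  by_cases hxy : dist x y < δ
  · have := (h x hx y hy hxy).le
    rw [Real.dist_eq] at this
    have : 0 ≤ 2 * M / δ ^ 2 * sqDist x y := by positivity
    linarith
  · have hle : δ ^ 2 ≤ sqDist x y := by
      by_contra! hlt
      refine hxy ((dist_pi_lt_iff hδ).2 fun k => ?_)
      rw [Real.dist_eq]
      refine abs_lt_of_sq_lt_sq (lt_of_le_of_lt ?_ hlt) hδ.le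
      exact Finset.single_le_sum (f := fun k => (x k - y k) ^ 2) (fun l _ => sq_nonneg _)
        (Finset.mem_univ k)
    have h1 : |f x - f y| ≤ 2 * M := by
      have := abs_sub (f x) (f y)
      linarith [hM x, hM y]
    have h2 : 2 * M ≤ 2 * M / δ ^ 2 * sqDist x y := by
      rw [div_mul_eq_mul_div, le_div_iff₀ (by positivity)]
      gcongr
    linarith

theorem tendsto_integral_evolve_sub {N : ℕ} (hN : 2 ≤ N) {μ ν : Measure (Fin N → ℝ)}
    [IsProbabilityMeasure μ] [IsProbabilityMeasure ν] (hμ : μ (stdSimplex ℝ (Fin N)) = 1)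
    (hν : ν (stdSimplex ℝ (Fin N)) = 1) (f : BoundedContinuousFunction (Fin N → ℝ) ℝ) :
    Tendsto (fun t => ∫ x, f x ∂(evolve (cfK N) t μ) - ∫ x, f x ∂(evolve (cfK N) t ν)) atTop
      (𝓝 0) := by
  rw [Metric.tendsto_atTop]
  intro ε hε
  have hM : ∀ x, |f x| ≤ ‖f‖ := fun x => f.norm_coe_le_norm x
  obtain ⟨C, hC, h⟩ := exists_abs_sub_le_add_mul_sqDist f.continuous hM (half_pos hε)
  have hlim : Tendsto (fun t : ℕ => C * cfRate N ^ t * 2) atTop (𝓝 0) := by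
    simpa using ((tendsto_pow_atTop_nhds_zero_of_lt_one (cfRate_nonneg hN)
      (cfRate_lt_one hN)).const_mul C).mul_const 2
  obtain ⟨T, hT⟩ := eventually_atTop.1 (hlim.eventually_lt_const (half_pos hε))
  refine ⟨T, fun t ht => ?_⟩
  rw [dist_zero_right, Real.norm_eq_abs]
  have := abs_integral_evolve_sub_le hN hμ hν t hC f.continuous.measurable hM h
  linarith [hT t ht]

theorem evolve_eq_self {α : Type*} [MeasurableSpace α] {κ : α → Measure α} {μ : Measure α}
    (h : μ.bind κ = μ) (t : ℕ) : evolve κ t μ = μ := by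
  induction t with
  | zero => rfl
  | succ t ih => rw [evolve, ih, h]

/-- The direction along which mass is exchanged between the coordinates `i` and `j`. -/
noncomputable def exchangeDir {N : ℕ} (i j : Fin N) : Fin N → ℝ := Pi.single i 1 - Pi.single j 1

theorem sum_exchangeDir {N : ℕ} (i j : Fin N) : ∑ k, exchangeDir i j k = 0 := by
  simp [exchangeDir, Finset.sum_sub_distrib]

theorem cfT_eq_add_smul {N : ℕ} {i j : Fin N} (hij : i ≠ j) (u : ℝ) (x : Fin N → ℝ) :
    cfT N i j u x = x + (u * (x i + x j) - x i) • exchangeDir i j := by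
  ext k
  by_cases hj : k = j
  · subst hj
    rw [cfT_snd]
    simp [exchangeDir, hij.symm]
    ring
  by_cases hi : k = i
  · subst hi
    rw [cfT_fst hij]
    simp [exchangeDir, hij]
  · rw [cfT_of_ne hi hj]
    simp [exchangeDir, hi, hj]

theorem cfT_fst_add_snd {N : ℕ} {i j : Fin N} (hij : i ≠ j) (u : ℝ) (x : Fin N → ℝ) :
    cfT N i j u x i + cfT N i j u x j = x i + x j := by
  rw [cfT_fst hij, cfT_snd]
  ring

theorem cfT_eq_self {N : ℕ} {i j : Fin N} (hij : i ≠ j) (u : ℝ) {x : Fin N → ℝ}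
    (hi : x i = 0) (hj : x j = 0) : cfT N i j u x = x := by
  rw [cfT_eq_add_smul hij, hi, hj]
  simp

/-- The points of the simplex at which the coordinates `i` and `j` carry positive total mass. -/
def posPairSimplex {N : ℕ} (i j : Fin N) : Set (Fin N → ℝ) :=
  stdSimplex ℝ (Fin N) ∩ {x | 0 < x i + x j}

theorem measurableSet_posPairSimplex {N : ℕ} (i j : Fin N) :
    MeasurableSet (posPairSimplex i j) :=
  (isClosed_stdSimplex ℝ (Fin N)).measurableSet.inter
    (measurableSet_lt measurable_const (by fun_prop))

theorem cfT_mem_posPairSimplex_iff {N : ℕ} {i j : Fin N} (hij : i ≠ j) (u : ℝ) {x : Fin N → ℝ}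
    (hx : x ∈ posPairSimplex i j) :
    cfT N i j u x ∈ posPairSimplex i j ↔ u ∈ Set.Icc (0 : ℝ) 1 := by
  have hs : 0 < x i + x j := hx.2
  constructor
  · rintro ⟨h, -⟩
    have h1 := h.1 i
    have h2 := h.1 j
    rw [cfT_fst hij] at h1
    rw [cfT_snd] at h2
    exact ⟨nonneg_of_mul_nonneg_left h1 hs, sub_nonneg.1 (nonneg_of_mul_nonneg_left h2 hs)⟩
  · intro hu
    refine ⟨cfT_mem_stdSimplex hij hu hx.1, ?_⟩
    rw [Set.mem_ofPred_eq, cfT_fst_add_snd hij]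
    exact hs

theorem lintegral_eq_mul_lintegral_comp_affine {s : ℝ} (hs : 0 < s) (a : ℝ) {g : ℝ → ℝ≥0∞}
    (hg : Measurable g) :
    ∫⁻ t, g t = ENNReal.ofReal s * ∫⁻ u, g (u * s - a) := by
  rw [← lintegral_sub_right_eq_self g a]
  conv_lhs => rw [← Real.smul_map_volume_mul_right hs.ne', abs_of_pos hs]
  rw [lintegral_smul_measure, smul_eq_mul,
    lintegral_map (f := fun t => g (t - a)) (hg.comp (measurable_sub_const a))
      (measurable_mul_const s)]

theorem lintegral_indicator_exchangeDir {N : ℕ} {i j : Fin N} (hij : i ≠ j)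
    {f : (Fin N → ℝ) → ℝ≥0∞} (hf : Measurable f) {x : Fin N → ℝ} (hx : x ∈ posPairSimplex i j) :
    ∫⁻ t : ℝ, (posPairSimplex i j).indicator f (x + t • exchangeDir i j) =
      ENNReal.ofReal (x i + x j) * ∫⁻ u in Set.Icc (0 : ℝ) 1, f (cfT N i j u x) := by
  have hm := hf.indicator (measurableSet_posPairSimplex i j)
  rw [lintegral_eq_mul_lintegral_comp_affine hx.2 (x i)
    (g := fun t => (posPairSimplex i j).indicator f (x + t • exchangeDir i j))
    (hm.comp (by fun_prop)),
    ← lintegral_indicator measurableSet_Icc]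
  simp only [← cfT_eq_add_smul hij]
  congr 2
  ext u
  have h := cfT_mem_posPairSimplex_iff hij u hx
  by_cases hu : u ∈ Set.Icc (0 : ℝ) 1
  · rw [Set.indicator_of_mem (h.2 hu), Set.indicator_of_mem hu]
  · rw [Set.indicator_of_notMem (h.not.2 hu), Set.indicator_of_notMem hu]

theorem setLIntegral_lintegral_cfT {N : ℕ} {i j : Fin N} (hij : i ≠ j)
    {ν : Measure (Fin N → ℝ)} [SFinite ν]
    (hν : ∀ F : (Fin N → ℝ) → ℝ≥0∞, Measurable F → ∀ t : ℝ,
      ∫⁻ x, F (x + t • exchangeDir i j) ∂ν = ∫⁻ x, F x ∂ν)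
    {f : (Fin N → ℝ) → ℝ≥0∞} (hf : Measurable f) :
    ∫⁻ x in stdSimplex ℝ (Fin N), (∫⁻ u in Set.Icc (0 : ℝ) 1, f (cfT N i j u x)) ∂ν =
      ∫⁻ x in stdSimplex ℝ (Fin N), f x ∂ν := by
  set P := posPairSimplex i j
  have hPm : MeasurableSet P := measurableSet_posPairSimplex i j
  set v := exchangeDir i j
  set w : (Fin N → ℝ) → ℝ≥0∞ := P.indicator fun x => (ENNReal.ofReal (x i + x j))⁻¹ with hw
  have hwm0 : Measurable fun x : Fin N → ℝ => (ENNReal.ofReal (x i + x j))⁻¹ := by fun_prop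
  have hwm : Measurable w := hwm0.indicator hPm
  have hfm : Measurable (P.indicator f) := hf.indicator hPm
  have hsplit (F : (Fin N → ℝ) → ℝ≥0∞) : ∫⁻ x in stdSimplex ℝ (Fin N), F x ∂ν =
      ∫⁻ x in P, F x ∂ν + ∫⁻ x in stdSimplex ℝ (Fin N) \ {x | 0 < x i + x j}, F x ∂ν :=
    (lintegral_inter_add_sdiff F _ (measurableSet_lt measurable_const (by fun_prop))).symm
  rw [hsplit, hsplit]
  congr 1
  · have h1 : ∀ x, P.indicator (fun x => ∫⁻ u in Set.Icc (0 : ℝ) 1, f (cfT N i j u x)) x =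
        ∫⁻ t : ℝ, w x * P.indicator f (x + t • v) := fun x => by
      by_cases hx : x ∈ P
      · have hs : 0 < x i + x j := hx.2
        rw [lintegral_const_mul (f := fun t : ℝ => P.indicator f (x + t • v)) _
            (hfm.comp (by fun_prop)),
          lintegral_indicator_exchangeDir hij hf hx, hw, Set.indicator_of_mem hx,
          Set.indicator_of_mem hx, ← mul_assoc,
          ENNReal.inv_mul_cancel (ENNReal.ofReal_pos.2 hs).ne' ENNReal.ofReal_ne_top, one_mul]
      · simp [hw, hx]
    have h2 : ∀ x, ∫⁻ t : ℝ, w (x - t • v) * P.indicator f x = P.indicator f x := fun x => by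
      by_cases hx : x ∈ P
      · have hs : 0 < x i + x j := hx.2
        rw [lintegral_mul_const (f := fun t : ℝ => w (x - t • v)) _ (hwm.comp (by fun_prop)),
          ← lintegral_neg_eq_self]
        simp only [neg_smul, sub_neg_eq_add]
        rw [lintegral_indicator_exchangeDir hij hwm0 hx]
        simp only [cfT_fst_add_snd hij, lintegral_const, Measure.restrict_apply_univ,
          Real.volume_Icc, sub_zero, ENNReal.ofReal_one, mul_one]
        rw [ENNReal.mul_inv_cancel (ENNReal.ofReal_pos.2 hs).ne' ENNReal.ofReal_ne_top, one_mul]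
      · simp [hx]
    have hadd : Measurable fun q : (Fin N → ℝ) × ℝ => q.1 + q.2 • v := by fun_prop
    have hsub : Measurable fun q : (Fin N → ℝ) × ℝ => q.1 - q.2 • v := by fun_prop
    rw [← lintegral_indicator hPm, ← lintegral_indicator hPm]
    calc ∫⁻ x, P.indicator (fun x => ∫⁻ u in Set.Icc (0 : ℝ) 1, f (cfT N i j u x)) x ∂ν
        = ∫⁻ x, (∫⁻ t : ℝ, w x * P.indicator f (x + t • v)) ∂ν := lintegral_congr h1
      _ = ∫⁻ t : ℝ, ∫⁻ x, w x * P.indicator f (x + t • v) ∂ν :=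
          lintegral_lintegral_swap
            ((hwm.comp measurable_fst).mul (hfm.comp hadd)).aemeasurable
      _ = ∫⁻ t : ℝ, ∫⁻ x, w (x - t • v) * P.indicator f x ∂ν := by
          refine lintegral_congr fun t => ?_
          rw [← hν (fun x => w (x - t • v) * P.indicator f x)
            ((hwm.comp (by fun_prop)).mul hfm) t]
          simp only [add_sub_cancel_right]
      _ = ∫⁻ x, (∫⁻ t : ℝ, w (x - t • v) * P.indicator f x) ∂ν :=
          (lintegral_lintegral_swap
            ((hwm.comp hsub).mul (hfm.comp measurable_fst)).aemeasurable).symm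
      _ = ∫⁻ x, P.indicator f x ∂ν := lintegral_congr h2
  · refine setLIntegral_congr_fun ((isClosed_stdSimplex ℝ (Fin N)).measurableSet.diff
      (measurableSet_lt measurable_const (by fun_prop))) fun x hx => ?_
    have hs : x i + x j ≤ 0 := not_lt.1 hx.2
    have hi := hx.1.1 i
    have hj := hx.1.1 j
    simp only [cfT_eq_self hij _ (show x i = 0 by linarith) (show x j = 0 by linarith)]
    simp

/-- The affine hyperplane containing the standard simplex. -/
def sumOneHyperplane (N : ℕ) : Set (Fin N → ℝ) := {x | ∑ k, x k = 1}

theorem measurableSet_sumOneHyperplane (N : ℕ) : MeasurableSet (sumOneHyperplane N) :=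
  measurableSet_eq_fun (by fun_prop) measurable_const

/-- The linear form summing the coordinates. -/
noncomputable def sumForm (N : ℕ) : Module.Dual ℝ (Fin N → ℝ) := ∑ k, LinearMap.proj k

theorem sumForm_apply {N : ℕ} (x : Fin N → ℝ) : sumForm N x = ∑ k, x k := by
  simp [sumForm]

/-- The isometric parametrization of the hyperplane by its direction, centred at the barycentre. -/
noncomputable def hyperplaneParam (N : ℕ) (w : LinearMap.ker (sumForm N)) : Fin N → ℝ :=
  (fun _ => (N : ℝ)⁻¹) + (w : Fin N → ℝ)

theorem isometry_hyperplaneParam (N : ℕ) : Isometry (hyperplaneParam N) :=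
  (IsometryEquiv.addLeft (fun _ : Fin N => (N : ℝ)⁻¹)).isometry.comp isometry_subtype_coe

theorem range_hyperplaneParam {N : ℕ} (hN : 2 ≤ N) :
    Set.range (hyperplaneParam N) = sumOneHyperplane N := by
  have hN0 : (N : ℝ) ≠ 0 := by positivity
  ext x
  constructor
  · rintro ⟨w, rfl⟩
    have hw : ∑ k, (w : Fin N → ℝ) k = 0 := by rw [← sumForm_apply]; exact w.2
    simp [sumOneHyperplane, hyperplaneParam, Finset.sum_add_distrib, hw, hN0]
  · intro hx
    have hx' : ∑ k, x k = 1 := hx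
    refine ⟨⟨x - fun _ => (N : ℝ)⁻¹, ?_⟩, ?_⟩
    · rw [LinearMap.mem_ker, sumForm_apply]
      simp [hx', hN0]
    · simp [hyperplaneParam]

theorem finrank_ker_sumForm {N : ℕ} (hN : 2 ≤ N) :
    (Module.finrank ℝ (LinearMap.ker (sumForm N)) : ℝ) = N - 1 := by
  have hne : sumForm N ≠ 0 := fun h => by
    have := LinearMap.congr_fun h (fun _ => 1)
    rw [sumForm_apply] at this
    simp at this
    omega
  have h := Module.Dual.finrank_ker_add_one_of_ne_zero hne
  rw [Module.finrank_fin_fun] at h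
  rw [eq_sub_iff_add_eq]
  exact_mod_cast h

theorem isAddHaarMeasure_hausdorffMeasure_ker {N : ℕ} (hN : 2 ≤ N) :
    (μH[(N : ℝ) - 1] : Measure (LinearMap.ker (sumForm N))).IsAddHaarMeasure := by
  rw [← finrank_ker_sumForm hN]
  infer_instance

theorem map_hyperplaneParam {N : ℕ} (hN : 2 ≤ N) :
    (μH[(N : ℝ) - 1] : Measure (LinearMap.ker (sumForm N))).map (hyperplaneParam N) =
      μH[(N : ℝ) - 1].restrict (sumOneHyperplane N) := by
  have : (2 : ℝ) ≤ N := by exact_mod_cast hN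
  rw [(isometry_hyperplaneParam N).map_hausdorffMeasure (Or.inl (by linarith)),
    range_hyperplaneParam hN]

theorem sFinite_hausdorffMeasure_restrict {N : ℕ} (hN : 2 ≤ N) :
    SFinite ((μH[(N : ℝ) - 1] : Measure (Fin N → ℝ)).restrict (sumOneHyperplane N)) := by
  have := isAddHaarMeasure_hausdorffMeasure_ker hN
  rw [← map_hyperplaneParam hN]
  infer_instance

theorem stdSimplex_subset_sumOneHyperplane (N : ℕ) :
    stdSimplex ℝ (Fin N) ⊆ sumOneHyperplane N := fun _ hx => hx.2

theorem hausdorffMeasure_stdSimplex_eq {N : ℕ} (hN : 2 ≤ N) :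
    μH[(N : ℝ) - 1] (stdSimplex ℝ (Fin N)) =
      (μH[(N : ℝ) - 1] : Measure (LinearMap.ker (sumForm N)))
        (hyperplaneParam N ⁻¹' stdSimplex ℝ (Fin N)) := by
  have hm := (isClosed_stdSimplex ℝ (Fin N)).measurableSet
  rw [← Measure.map_apply (isometry_hyperplaneParam N).continuous.measurable hm,
    map_hyperplaneParam hN, Measure.restrict_apply hm,
    Set.inter_eq_left.2 (stdSimplex_subset_sumOneHyperplane N)]

theorem hausdorffMeasure_stdSimplex_ne_zero {N : ℕ} (hN : 2 ≤ N) :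
    μH[(N : ℝ) - 1] (stdSimplex ℝ (Fin N)) ≠ 0 := by
  have := isAddHaarMeasure_hausdorffMeasure_ker hN
  rw [hausdorffMeasure_stdSimplex_eq hN]
  have hopen : IsOpen (hyperplaneParam N ⁻¹' {x | ∀ k, 0 < x k}) := by
    refine IsOpen.preimage (isometry_hyperplaneParam N).continuous ?_
    simp only [Set.ofPred_forall]
    exact isOpen_iInter_of_finite fun k => isOpen_lt continuous_const (continuous_apply k)
  have hne : (hyperplaneParam N ⁻¹' {x | ∀ k, 0 < x k}).Nonempty := by
    refine ⟨0, fun k => ?_⟩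
    have : (0 : ℝ) < N := by positivity
    simpa [hyperplaneParam] using this
  refine (lt_of_lt_of_le (hopen.measure_pos μH[(N : ℝ) - 1] hne) (measure_mono ?_)).ne'
  intro w hw
  exact ⟨fun k => (hw k).le, (range_hyperplaneParam hN).subset ⟨w, rfl⟩⟩

theorem hausdorffMeasure_stdSimplex_ne_top {N : ℕ} (hN : 2 ≤ N) :
    μH[(N : ℝ) - 1] (stdSimplex ℝ (Fin N)) ≠ ∞ := by
  have := isAddHaarMeasure_hausdorffMeasure_ker hN
  rw [hausdorffMeasure_stdSimplex_eq hN]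
  exact ((isometry_hyperplaneParam N).isClosedEmbedding.isCompact_preimage
    (isCompact_stdSimplex ℝ (Fin N))).measure_lt_top.ne

theorem lintegral_restrict_sumOneHyperplane_add (N : ℕ) (d : ℝ) {v : Fin N → ℝ}
    (hv : ∑ k, v k = 0) {F : (Fin N → ℝ) → ℝ≥0∞} :
    ∫⁻ x in sumOneHyperplane N, F (x + v) ∂μH[d] = ∫⁻ x in sumOneHyperplane N, F x ∂μH[d] := by
  have hm := measurableSet_sumOneHyperplane N
  rw [← lintegral_indicator hm, ← lintegral_indicator hm,
    ← lintegral_add_right_eq_self ((sumOneHyperplane N).indicator F) v]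
  congr 1
  ext x
  have : x + v ∈ sumOneHyperplane N ↔ x ∈ sumOneHyperplane N := by
    simp [sumOneHyperplane, Finset.sum_add_distrib, hv]
  by_cases hx : x ∈ sumOneHyperplane N
  · rw [Set.indicator_of_mem hx, Set.indicator_of_mem (this.2 hx)]
  · rw [Set.indicator_of_notMem hx, Set.indicator_of_notMem (this.not.2 hx)]

theorem lintegral_uniformSimplex {N : ℕ} (F : (Fin N → ℝ) → ℝ≥0∞) :
    ∫⁻ x, F x ∂(uniformSimplex N) = (μH[(N : ℝ) - 1] (stdSimplex ℝ (Fin N)))⁻¹ *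
      ∫⁻ x in stdSimplex ℝ (Fin N), F x ∂(μH[(N : ℝ) - 1].restrict (sumOneHyperplane N)) := by
  rw [uniformSimplex, lintegral_smul_measure, smul_eq_mul,
    Measure.restrict_restrict (isClosed_stdSimplex ℝ (Fin N)).measurableSet,
    Set.inter_eq_left.2 (stdSimplex_subset_sumOneHyperplane N)]

theorem uniformSimplex_stdSimplex {N : ℕ} (hN : 2 ≤ N) :
    uniformSimplex N (stdSimplex ℝ (Fin N)) = 1 := by
  rw [uniformSimplex, Measure.smul_apply, Measure.restrict_apply_self, smul_eq_mul]
  exact ENNReal.inv_mul_cancel (hausdorffMeasure_stdSimplex_ne_zero hN)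
    (hausdorffMeasure_stdSimplex_ne_top hN)

theorem isProbabilityMeasure_uniformSimplex {N : ℕ} (hN : 2 ≤ N) :
    IsProbabilityMeasure (uniformSimplex N) := by
  constructor
  rw [← uniformSimplex_stdSimplex hN]
  simp [uniformSimplex]

theorem lintegral_lintegral_cfT_uniformSimplex {N : ℕ} (hN : 2 ≤ N) {i j : Fin N} (hij : i ≠ j)
    {f : (Fin N → ℝ) → ℝ≥0∞} (hf : Measurable f) :
    ∫⁻ x, (∫⁻ u in Set.Icc (0 : ℝ) 1, f (cfT N i j u x)) ∂(uniformSimplex N) =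
      ∫⁻ x, f x ∂(uniformSimplex N) := by
  have := sFinite_hausdorffMeasure_restrict hN
  rw [lintegral_uniformSimplex, lintegral_uniformSimplex]
  congr 1
  refine setLIntegral_lintegral_cfT hij (fun F _ t => ?_) hf
  refine lintegral_restrict_sumOneHyperplane_add N _ ?_
  simp [← Finset.mul_sum, sum_exchangeDir]

theorem uniformSimplex_bind_cfK {N : ℕ} (hN : 2 ≤ N) :
    (uniformSimplex N).bind (cfK N) = uniformSimplex N := by
  ext s hs
  have hm : Measurable (s.indicator (1 : (Fin N → ℝ) → ℝ≥0∞)) := measurable_one.indicator hs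
  have hmeas (p : Fin N × Fin N) : Measurable fun x =>
      ∫⁻ u in Set.Icc (0 : ℝ) 1, s.indicator (1 : (Fin N → ℝ) → ℝ≥0∞) (cfT N p.1 p.2 u x) :=
    Measurable.lintegral_prod_right'
      (f := fun q : (Fin N → ℝ) × ℝ => s.indicator 1 (cfT N p.1 p.2 q.2 q.1))
      (hm.comp (continuous_cfT N p.1 p.2).measurable)
  rw [← lintegral_indicator_one hs, ← lintegral_indicator_one hs,
    Measure.lintegral_bind (measurable_cfK N).aemeasurable hm.aemeasurable]
  simp only [lintegral_cfK N hm]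
  rw [lintegral_const_mul _ (Finset.measurable_sum _ fun p _ => hmeas p),
    lintegral_finsetSum _ fun p _ => hmeas p,
    Finset.sum_congr rfl fun p hp =>
      lintegral_lintegral_cfT_uniformSimplex hN (Finset.mem_filter.1 hp).2 hm,
    Finset.sum_const, nsmul_eq_mul, natCast_card_filter_ne hN, ← mul_assoc,
    inv_mul_natCast_mul_sub_one hN, one_mul]

theorem tendsto_integral_evolve_cfK {N : ℕ} (hN : 2 ≤ N) {μ : Measure (Fin N → ℝ)}
    [IsProbabilityMeasure μ] (hμ : μ (stdSimplex ℝ (Fin N)) = 1)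
    (f : BoundedContinuousFunction (Fin N → ℝ) ℝ) :
    Tendsto (fun t : ℕ => ∫ x, f x ∂(evolve (cfK N) t μ)) atTop
      (𝓝 (∫ x, f x ∂(uniformSimplex N))) := by
  have := isProbabilityMeasure_uniformSimplex hN
  have h := tendsto_integral_evolve_sub hN hμ (uniformSimplex_stdSimplex hN) f
  simp only [evolve_eq_self (uniformSimplex_bind_cfK hN)] at h
  exact tendsto_sub_nhds_zero_iff.1 h

/-- The uniform distribution on `Δ_{N-1}` is an invariant probability measure for the
coagulation–fragmentation kernel `K`, it is the unique invariant probability measure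
(among probability measures on the simplex), and for every initial probability
distribution `μ₀` on `Δ_{N-1}` the time-`t` marginals `μ₀ K^t` converge weakly to the
uniform distribution as `t → ∞`. -/
theorem uniformSimplex_unique_invariant_and_weak_convergence (N : ℕ) (hN : 2 ≤ N) :
    IsProbabilityMeasure (uniformSimplex N) ∧
    (uniformSimplex N).bind (cfK N) = uniformSimplex N ∧
    (∀ μ : Measure (Fin N → ℝ), IsProbabilityMeasure μ →
      μ (stdSimplex ℝ (Fin N)) = 1 → μ.bind (cfK N) = μ → μ = uniformSimplex N) ∧
    (∀ μ₀ : Measure (Fin N → ℝ), IsProbabilityMeasure μ₀ →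
      μ₀ (stdSimplex ℝ (Fin N)) = 1 →
      ∀ f : BoundedContinuousFunction (Fin N → ℝ) ℝ,
        Tendsto (fun t : ℕ => ∫ x, f x ∂(evolve (cfK N) t μ₀)) atTop
          (𝓝 (∫ x, f x ∂(uniformSimplex N)))) := by
  refine ⟨isProbabilityMeasure_uniformSimplex hN, uniformSimplex_bind_cfK hN, ?_, ?_⟩
  · intro μ hμ hμS hinv
    have := isProbabilityMeasure_uniformSimplex hN
    refine ext_of_forall_integral_eq_of_IsFiniteMeasure fun f => ?_
    have h := tendsto_integral_evolve_cfK hN hμS f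
    simp only [evolve_eq_self hinv] at h
    exact tendsto_nhds_unique tendsto_const_nhds h
  · intro μ₀ hμ₀ hμ₀S f
    exact tendsto_integral_evolve_cfK hN hμ₀S f
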